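/- Classification of 2-cyclic Maya diagrams: a canonical Maya diagram M admits a finite set F of nonnegative integers with |F| = 2 and M Δ F = M ⊕ k for some k ≥ 1 if and only if k = 2 and the positive part of M is the Umemura staircase M₊ = {1, 3, 5, …, 2m−1} for some m ≥ 0, in which case necessarily F = {0, 2m+1}. -/

import Mathlib

/-- A Maya diagram in canonical form: it contains every negative integer,
does not contain `0`, and its nonnegative part is finite. -/
def IsCanonicalMaya (M : Set ℤ) : Prop :=
  (∀ n : ℤ, n < 0 → n ∈ M) ∧ (0 : ℤ) ∉ M ∧ {n : ℤ | n ∈ M ∧ 0 ≤ n}.Finite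

/-- The translate `M ⊕ k = {n + k : n ∈ M}`. -/
def mayaShift (M : Set ℤ) (k : ℤ) : Set ℤ := (fun n => n + k) '' M

/-- A finite set of nonnegative integers, viewed as a set of integers (the flip levels). -/
def finsetFlips (F : Finset ℕ) : Set ℤ := (fun n : ℕ => (n : ℤ)) '' ↑F

/-- The positive part of a canonical Maya diagram, as a set of naturals. -/
def mayaPos (M : Set ℤ) : Set ℕ := {n : ℕ | (n : ℤ) ∈ M}

/-- The Umemura staircase `{1, 3, 5, …, 2m-1}`. -/
def umemuraStaircase (m : ℕ) : Set ℕ := {n : ℕ | ∃ i < m, n = 2 * i + 1}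

theorem mem_mayaShift {M : Set ℤ} {k x : ℤ} : x ∈ mayaShift M k ↔ x - k ∈ M := by
  constructor
  · rintro ⟨n, hn, rfl⟩
    simpa using hn
  · intro h
    exact ⟨x - k, h, by simp⟩

theorem mem_finsetFlips_pair {b : ℕ} {x : ℤ} :
    x ∈ finsetFlips ({0, b} : Finset ℕ) ↔ x = 0 ∨ x = b := by
  simp [finsetFlips, Set.image_insert_eq]

theorem symmDiff_finsetFlips_pair_eq_mayaShift_iff {M : Set ℤ} {b : ℕ} {k : ℤ} :
    symmDiff M (finsetFlips ({0, b} : Finset ℕ)) = mayaShift M k ↔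
      ∀ x : ℤ, (x - k ∈ M ↔ ¬ (x ∈ M ↔ (x = 0 ∨ x = b))) := by
  rw [Set.ext_iff]
  refine forall_congr' fun x => ?_
  rw [Set.mem_symmDiff, mem_mayaShift, mem_finsetFlips_pair]
  tauto

/-- A canonical Maya diagram contains no infinite ascending arithmetic progression. -/
theorem IsCanonicalMaya.exists_add_mul_notMem {M : Set ℤ} (hM : IsCanonicalMaya M)
    (x : ℤ) {k : ℤ} (hk : 0 < k) : ∃ j : ℕ, x + j * k ∉ M := by
  obtain ⟨B, hB⟩ := hM.2.2.bddAbove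
  by_contra! h
  have hlarge : ((B - x).toNat + x.natAbs + 1 : ℤ) ≤
      (((B - x).toNat + x.natAbs + 1 : ℕ) : ℤ) * k := by
    push_cast
    nlinarith [abs_nonneg x]
  have hle := hB ⟨h ((B - x).toNat + x.natAbs + 1), by omega⟩
  omega

/-- If flipping `0` and `b` shifts a canonical Maya diagram by `k`, then every positive
progression of step `k` that is preceded by a filled site passes through `b`. -/
theorem IsCanonicalMaya.exists_flip_of_mem {M : Set ℤ} (hM : IsCanonicalMaya M) {b : ℕ} {k : ℤ}
    (hk : 0 < k) (h : ∀ x : ℤ, (x - k ∈ M ↔ ¬ (x ∈ M ↔ (x = 0 ∨ x = b))))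
    {x : ℤ} (hx : 0 < x) (hxM : x - k ∈ M) : ∃ j : ℕ, x + j * k = b := by
  by_contra! hb
  obtain ⟨j, hj⟩ := hM.exists_add_mul_notMem x hk
  refine hj ?_
  clear hj
  induction j with
  | zero =>
    have h0 := h x
    have := hb 0
    simp only [Nat.cast_zero, zero_mul, add_zero] at this ⊢
    have : x ≠ 0 := by omega
    tauto
  | succ j ih =>
    have h0 := h (x + (j + 1 : ℕ) * k)
    have hne := hb (j + 1)
    have hpos : x + ((j + 1 : ℕ) : ℤ) * k ≠ 0 := by positivity
    have he : x + ((j + 1 : ℕ) : ℤ) * k - k = x + j * k := by push_cast; ring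
    rw [he] at h0
    tauto

/-- classification of 2-cyclic Maya diagrams: a canonical Maya diagram
`M` admits a two-element flip set `F` of nonnegative integers with `M Δ F = M ⊕ k`,
`k ≥ 1`, if and only if `k = 2` and the positive part of `M` is an Umemura staircase
`{1, 3, …, 2m-1}`; and in that case necessarily `F = {0, 2m+1}`. -/
theorem two_cyclic_maya_classification (M : Set ℤ) (hM : IsCanonicalMaya M) :
    (∀ (F : Finset ℕ) (k : ℕ), 1 ≤ k → F.card = 2 →
        symmDiff M (finsetFlips F) = mayaShift M (k : ℤ) →
        k = 2 ∧ ∃ m : ℕ, mayaPos M = umemuraStaircase m ∧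
          F = ({0, 2 * m + 1} : Finset ℕ)) ∧
    (∀ m : ℕ, mayaPos M = umemuraStaircase m →
        symmDiff M (finsetFlips ({0, 2 * m + 1} : Finset ℕ)) = mayaShift M (2 : ℤ)) := by
  refine ⟨fun F k hk hF h => ?_, fun m hm => ?_⟩
  · have h0F : 0 ∈ F := by
      have h0 : (0 : ℤ) ∈ mayaShift M k := mem_mayaShift.2 (hM.1 _ (by omega))
      rw [← h, Set.mem_symmDiff] at h0
      have := hM.2.1
      simpa [this, finsetFlips] using h0
    obtain ⟨b, hb0, rfl⟩ : ∃ b : ℕ, b ≠ 0 ∧ F = {0, b} := by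
      obtain ⟨x, y, hxy, rfl⟩ := Finset.card_eq_two.1 hF
      rcases Finset.mem_insert.1 h0F with h0 | h0
      · exact ⟨y, by omega, by rw [h0]⟩
      · have h0 := Finset.mem_singleton.1 h0
        exact ⟨x, by omega, by rw [h0, Finset.pair_comm]⟩
    rw [symmDiff_finsetFlips_pair_eq_mayaShift_iff] at h
    have hmeet := fun x => hM.exists_flip_of_mem (x := x) (by omega) h
    have hk2 : k = 2 := by
      rcases (by omega : k = 1 ∨ k = 2 ∨ 3 ≤ k) with rfl | rfl | hk3
      · exfalso
        have hlt : ∀ j : ℕ, j < b → (j : ℤ) ∉ M := by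
          intro j
          induction j with
          | zero => exact fun _ => hM.2.1
          | succ j ih =>
            intro hj hmem
            have := h (j + 1 : ℕ)
            have he : ((j + 1 : ℕ) : ℤ) - (1 : ℕ) = j := by push_cast; ring
            rw [he] at this
            have := ih (by omega)
            have : ((j + 1 : ℕ) : ℤ) ≠ 0 := by omega
            have : ((j + 1 : ℕ) : ℤ) ≠ b := by omega
            tauto
        have hbM : (b : ℤ) ∈ M := by
          have := h b
          have hp := hlt (b - 1) (by omega)
          rw [show ((b - 1 : ℕ) : ℤ) = b - (1 : ℕ) by omega] at hp
          tauto
        obtain ⟨j, hj⟩ := hmeet (b + 1) (by omega) (by simpa using hbM)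
        push_cast at hj
        omega
      · rfl
      · exfalso
        obtain ⟨i, hi⟩ := hmeet 1 (by omega) (hM.1 _ (by omega))
        obtain ⟨j, hj⟩ := hmeet 2 (by omega) (hM.1 _ (by omega))
        have hdvd : (k : ℤ) ∣ 1 := ⟨i - j, by linear_combination hj - hi⟩
        have := Int.le_of_dvd one_pos hdvd
        omega
    subst hk2
    obtain ⟨m, hm⟩ := hmeet 1 (by omega) (hM.1 _ (by norm_num))
    have hbm : b = 2 * m + 1 := by push_cast at hm; omega
    subst hbm
    refine ⟨rfl, m, ?_, rfl⟩
    have key : ∀ j : ℕ, ((2 * j : ℕ) : ℤ) ∉ M ∧ (((2 * j + 1 : ℕ) : ℤ) ∈ M ↔ j < m) := by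
      intro j
      induction j with
      | zero =>
        refine ⟨hM.2.1, ?_⟩
        have h1 := h 1
        have := hM.1 (1 - (2 : ℕ)) (by norm_num)
        have he : (1 : ℤ) = (2 * m + 1 : ℕ) ↔ ¬ 0 < m := by omega
        rw [he] at h1
        simp only [mul_zero, zero_add, Nat.cast_one]
        have : (1 : ℤ) ≠ 0 := one_ne_zero
        tauto
      | succ j ih =>
        have h1 := h (2 * (j + 1) : ℕ)
        have h2 := h (2 * (j + 1) + 1 : ℕ)
        rw [show ((2 * (j + 1) : ℕ) : ℤ) - (2 : ℕ) = (2 * j : ℕ) by omega] at h1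
        rw [show ((2 * (j + 1) + 1 : ℕ) : ℤ) - (2 : ℕ) = (2 * j + 1 : ℕ) by omega, ih.2] at h2
        have : ¬ (((2 * (j + 1) : ℕ) : ℤ) = 0 ∨ ((2 * (j + 1) : ℕ) : ℤ) = (2 * m + 1 : ℕ)) := by
          omega
        have he : (((2 * (j + 1) + 1 : ℕ) : ℤ) = 0 ∨
            ((2 * (j + 1) + 1 : ℕ) : ℤ) = (2 * m + 1 : ℕ)) ↔ j + 1 = m := by
          omega
        rw [he] at h2
        refine ⟨by tauto, ?_⟩
        by_cases hjm : j + 1 = m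
        · have : j < m := by omega
          have : ¬ j + 1 < m := by omega
          tauto
        · have : j < m ↔ j + 1 < m := by omega
          tauto
    ext n
    change (n : ℤ) ∈ M ↔ ∃ i < m, n = 2 * i + 1
    rcases Nat.even_or_odd' n with ⟨j, rfl | rfl⟩
    · refine iff_of_false (key j).1 ?_
      rintro ⟨i, _, hi⟩
      omega
    · rw [(key j).2]
      constructor
      · exact fun hj => ⟨j, hj, rfl⟩
      · rintro ⟨i, hi, he⟩
        omega
  · rw [symmDiff_finsetFlips_pair_eq_mayaShift_iff]
    have hmem : ∀ x : ℤ, x ∈ M ↔ x < 0 ∨ x % 2 = 1 ∧ x < 2 * m := by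
      intro x
      rcases lt_or_ge x 0 with hx | hx
      · exact iff_of_true (hM.1 x hx) (Or.inl hx)
      · lift x to ℕ using hx
        change x ∈ mayaPos M ↔ _
        rw [hm]
        change (∃ i < m, x = 2 * i + 1) ↔ _
        constructor
        · rintro ⟨i, hi, rfl⟩
          omega
        · intro hx
          exact ⟨x / 2, by omega, by omega⟩
    intro x
    rw [hmem, hmem]
    omega
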